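/- arXiv:1809.03231 — 2 statements merged into one kernel-verified Lean document; each statement's English description precedes it below -/
import Mathlib

section
/- Let 1/2 < q₀ < 1 and α > 1 - q₀, and set γ = (1 - q₀)/q₀. Define the sequence s_n = q₀ + (2q₀ - 1)·[(1 - γⁿ·(α - q₀)/(α - (1 - q₀)))^{-1} - 1] for n ≥ 0. Then s_0 = α, s_n·(1 - s_{n+1}) = q₀·(1 - q₀) for all n ≥ 0, and s_n → q₀ as n → ∞. -/
open Filter

/-- The explicit sequence s_n solves the discrete Riccati equation
s_n (1 - s_{n+1}) = q₀(1 - q₀) with s_0 = α, and converges to q₀. -/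
theorem riccati_explicit_solution
    (q₀ α γ : ℝ) (hq1 : 1 / 2 < q₀) (hq2 : q₀ < 1) (hα : 1 - q₀ < α)
    (hγ : γ = (1 - q₀) / q₀) (s : ℕ → ℝ)
    (hs : ∀ n, s n = q₀ + (2 * q₀ - 1) *
      ((1 - γ ^ n * (α - q₀) / (α - (1 - q₀)))⁻¹ - 1)) :
    s 0 = α ∧ (∀ n, s n * (1 - s (n + 1)) = q₀ * (1 - q₀)) ∧
      Tendsto s atTop (nhds q₀) := by
  have hq : 0 < q₀ := by linarith
  have ha : 0 < α - (1 - q₀) := by linarith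
  have hγ0 : 0 < γ := by rw [hγ]; exact div_pos (by linarith) hq
  have hγ1 : γ < 1 := by rw [hγ, div_lt_one hq]; linarith
  have hγq : γ * q₀ = 1 - q₀ := by rw [hγ]; field_simp
  obtain ⟨c, hc⟩ : ∃ c, c = (α - q₀) / (α - (1 - q₀)) := ⟨_, rfl⟩
  have hc1 : c < 1 := by rw [hc, div_lt_one ha]; linarith
  have hs' : ∀ n, s n = q₀ + (2 * q₀ - 1) * ((1 - γ ^ n * c)⁻¹ - 1) := by
    intro n
    rw [hs n, hc, mul_div_assoc]
  have hD : ∀ n, 0 < 1 - γ ^ n * c := by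
    intro n
    have h0 : 0 < γ ^ n := pow_pos hγ0 n
    have h1 : γ ^ n ≤ 1 := pow_le_one₀ hγ0.le hγ1.le
    nlinarith
  refine ⟨?_, ?_, ?_⟩
  · have h1 : 1 - c = (2 * q₀ - 1) / (α - (1 - q₀)) := by
      rw [hc]; field_simp; ring
    have h2 : 2 * q₀ - 1 ≠ 0 := by linarith
    rw [hs' 0, pow_zero, one_mul, h1, inv_div, mul_sub, mul_div_cancel₀ _ h2]
    ring
  · intro n
    have hx := hD n
    have hy := hD (n + 1)
    rw [hs' n, hs' (n + 1)]
    rw [pow_succ] at hy ⊢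
    generalize γ ^ n = g at *
    have e1 : q₀ + (2 * q₀ - 1) * ((1 - g * c)⁻¹ - 1)
        = q₀ * (1 - g * γ * c) / (1 - g * c) := by
      rw [eq_div_iff hx.ne']
      linear_combination (2 * q₀ - 1) * inv_mul_cancel₀ hx.ne' + (g * c) * hγq
    have e2 : 1 - (q₀ + (2 * q₀ - 1) * ((1 - g * γ * c)⁻¹ - 1))
        = (1 - q₀) * (1 - g * c) / (1 - g * γ * c) := by
      rw [eq_div_iff hy.ne']
      linear_combination (-(2 * q₀ - 1)) * inv_mul_cancel₀ hy.ne' + (-(g * c)) * hγq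
    rw [e1, e2]
    have hx' := hx.ne'
    have hy' := hy.ne'
    rw [div_mul_div_comm, div_eq_iff (mul_ne_zero hx' hy')]
    ring
  · have hp := tendsto_pow_atTop_nhds_zero_of_lt_one hγ0.le hγ1
    have h1 : Tendsto (fun n : ℕ => 1 - γ ^ n * c) atTop (nhds (1 - 0 * c)) :=
      (hp.mul_const c).const_sub 1
    have h2 := (((h1.inv₀ (by simp)).sub_const 1).const_mul (2 * q₀ - 1)).const_add q₀
    rw [funext hs']
    simpa using h2
end

section
/- With the notation above, if x₊ > 1 then there exists a constant C > 0 such that v_n(x₊) ≤ C·ζ(x₊)^n for all n ≥ 0, where ζ(x) = x - √(x² - 1) ∈ (0,1) for x > 1. -/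
open Filter Topology in
lemma abstract_bound (e : ℕ → ℝ) (M g : ℝ) (hM : 0 ≤ M) (hg0 : 0 < g) (hg1 : g < 1)
    (he0 : ∀ n, 0 ≤ e n) (hea : ∀ n, e (n + 1) ≤ e n) (heb : ∀ n, e n ≤ M * g ^ n)
    (v : ℝ → ℕ → ℝ) (hv0 : ∀ x, v x 0 = 0) (hv1 : ∀ x, v x 1 = 1)
    (hvr : ∀ x n, v x (n + 2) = (2 * x - (e n - e (n + 1))) * v x (n + 1) - v x n)
    (ζ : ℝ → ℝ) (hζ : ∀ x, ζ x = x - Real.sqrt (x ^ 2 - 1))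
    (xs : ℝ) (hxs : xs = sInf {x : ℝ | ∀ n, 1 ≤ n → 0 < v x n})
    (h1 : 1 < xs) :
    ∃ C > (0 : ℝ), ∀ n : ℕ, v xs n ≤ C * ζ xs ^ n := by
  have hζc : Continuous ζ := by
    have : ζ = fun x => x - Real.sqrt (x ^ 2 - 1) := funext hζ
    rw [this]; fun_prop
  have hζp : ∀ x, 1 < x → 0 < ζ x ∧ ζ x < 1 ∧ 2 * x * ζ x = ζ x ^ 2 + 1 := by
    intro x hx
    have hs : Real.sqrt (x ^ 2 - 1) ^ 2 = x ^ 2 - 1 := Real.sq_sqrt (by nlinarith)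
    have hs0 := Real.sqrt_nonneg (x ^ 2 - 1)
    rw [hζ]
    refine ⟨?_, ?_, ?_⟩ <;> nlinarith
  have hvc2 : ∀ n, Continuous (fun x => v x n) ∧ Continuous (fun x => v x (n + 1)) := by
    intro n
    induction n with
    | zero => simp only [hv0, zero_add, hv1]; exact ⟨continuous_const, continuous_const⟩
    | succ k ih =>
      refine ⟨ih.2, ?_⟩
      have := ih.1
      have := ih.2
      simp only [hvr]
      fun_prop
  have hvc : ∀ n, Continuous (fun x => v x n) := fun n => (hvc2 n).1
  set S := {x : ℝ | ∀ n, 1 ≤ n → 0 < v x n} with hS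
  have hne : S.Nonempty := by
    by_contra h
    rw [Set.not_nonempty_iff_eq_empty] at h
    rw [h, Real.sInf_empty] at hxs
    linarith
  have hbd : BddBelow S := by
    by_contra h
    rw [Real.sInf_of_not_bddBelow h] at hxs
    linarith
  have hnn : ∀ n, 0 ≤ v xs n := by
    intro n
    have hcl : xs ∈ closure S := hxs ▸ csInf_mem_closure hne hbd
    have hsub : S ⊆ {x | 0 ≤ v x n} := by
      intro x hx
      rcases Nat.eq_zero_or_pos n with h | h
      · simp [h, hv0]
      · exact (hx n h).le
    exact closure_minimal hsub (isClosed_le continuous_const (hvc n)) hcl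
  have hpos : ∀ n, 0 < v xs (n + 1) := by
    intro n
    induction n with
    | zero => simp [hv1]
    | succ k ih =>
      refine lt_of_le_of_ne (hnn _) (fun h => ?_)
      have h3 := hvr xs (k + 1)
      have h4 := hnn (k + 1 + 2)
      rw [show k + 1 + 1 = k + 2 from rfl] at *
      rw [← h] at h3
      linarith
  -- persistence
  have hpers : ∀ x, 1 < x → ∀ N, ζ x * (ζ x + e N) ≤ 1 → 0 < v x N →
      (ζ x + e N) * v x N ≤ v x (N + 1) → ∀ k, ζ x * (ζ x + e (N + k)) ≤ 1 ∧ 0 < v x (N + k) ∧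
      (ζ x + e (N + k)) * v x (N + k) ≤ v x (N + k + 1) := by
    intro x hx N a b c k
    obtain ⟨z0, z1, z2⟩ := hζp x hx
    induction k with
    | zero => exact ⟨a, b, c⟩
    | succ k ih =>
      obtain ⟨i1, i2, i3⟩ := ih
      have e0 := he0 (N + k)
      have e1 := hea (N + k)
      have hvp : 0 < v x (N + k + 1) := lt_of_lt_of_le (by positivity) i3
      rw [← add_assoc]
      refine ⟨le_trans (by gcongr) i1, hvp, ?_⟩
      have h3 := hvr x (N + k)
      rw [show N + k + 1 + 1 = N + k + 2 from rfl, h3]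
      -- v_n ≤ (2x - ζ - e_n) v_{n+1}
      have hy : 2 * x = ζ x + 1 / ζ x := by field_simp; linarith
      have key : v x (N + k) ≤ (1 / ζ x - e (N + k)) * v x (N + k + 1) := by
        have hp : 0 < ζ x + e (N + k) := by positivity
        have k1 : v x (N + k) ≤ v x (N + k + 1) / (ζ x + e (N + k)) := by
          rw [le_div_iff₀ hp]; linarith
        have k2 : 1 / (ζ x + e (N + k)) ≤ 1 / ζ x - e (N + k) := by
          rw [div_le_iff₀ hp]
          have : (1 / ζ x - e (N + k)) * (ζ x + e (N + k)) - 1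
            = e (N + k) * (1 - ζ x * (ζ x + e (N + k))) / ζ x := by field_simp; ring
          have : 0 ≤ e (N + k) * (1 - ζ x * (ζ x + e (N + k))) / ζ x := by
            apply div_nonneg (mul_nonneg e0 (by linarith)) z0.le
          linarith
        calc v x (N + k) ≤ 1 / (ζ x + e (N + k)) * v x (N + k + 1) := by
              rw [one_div_mul_eq_div]; exact k1
          _ ≤ _ := by gcongr
      rw [hy]
      linarith
  obtain ⟨z0, z1, z2⟩ := hζp xs h1
  have hstep : ∀ N, ζ xs * (ζ xs + e (N + 1)) < 1 →
      v xs (N + 2) ≤ (ζ xs + e (N + 1)) * v xs (N + 1) := by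
    intro N hN
    by_contra! hc
    have ev1 : ∀ᶠ x in 𝓝 xs, ζ x * (ζ x + e (N + 1)) < 1 :=
      (show Continuous (fun x => ζ x * (ζ x + e (N + 1))) by fun_prop).continuousAt.eventually_lt
        continuousAt_const hN
    have ev2 : ∀ᶠ x in 𝓝 xs, (ζ x + e (N + 1)) * v x (N + 1) < v x (N + 2) :=
      ((hζc.add continuous_const).mul (hvc (N + 1))).continuousAt.eventually_lt
        (hvc (N + 2)).continuousAt hc
    have ev3 : ∀ᶠ x in 𝓝 xs, ∀ k ∈ Finset.range (N + 1), 0 < v x (k + 1) := by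
      rw [Filter.eventually_all_finset]
      intro k _
      exact continuousAt_const.eventually_lt (hvc (k + 1)).continuousAt (hpos k)
    have ev4 : ∀ᶠ x in 𝓝 xs, 1 < x := lt_mem_nhds h1
    have ev := (ev1.and (ev2.and (ev3.and ev4)))
    obtain ⟨x, hlt, w1, w2, w3, w4⟩ :
        ∃ x, x < xs ∧ ζ x * (ζ x + e (N + 1)) < 1 ∧ (ζ x + e (N + 1)) * v x (N + 1) < v x (N + 2)
          ∧ (∀ k ∈ Finset.range (N + 1), 0 < v x (k + 1)) ∧ 1 < x := by
      have := (ev.filter_mono (nhdsWithin_le_nhds (s := Set.Iio xs))).and self_mem_nhdsWithin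
      obtain ⟨x, hx, hx'⟩ := this.exists
      exact ⟨x, hx', hx⟩
    have hmem : x ∈ S := by
      intro n hn
      rcases le_total n (N + 1) with h | h
      · obtain ⟨k, rfl⟩ := Nat.exists_eq_add_of_le' hn
        exact w3 k (Finset.mem_range.2 (by omega))
      · obtain ⟨k, rfl⟩ := Nat.exists_eq_add_of_le h
        exact (hpers x w4 (N + 1) w1.le (w3 N (by simp)) w2.le k).2.1
    have := csInf_le hbd hmem
    linarith
  have het : Tendsto e atTop (𝓝 0) := by
    refine squeeze_zero he0 heb ?_
    simpa using (tendsto_pow_atTop_nhds_zero_of_lt_one hg0.le hg1).const_mul M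
  have hev : ∀ᶠ n in atTop, ζ xs * (ζ xs + e n) < 1 := by
    have : Tendsto (fun n => ζ xs * (ζ xs + e n)) atTop (𝓝 (ζ xs * (ζ xs + 0))) :=
      (het.const_add _).const_mul _
    exact this.eventually_lt_const (by nlinarith)
  obtain ⟨N, hN⟩ := eventually_atTop.1 hev
  set B := M / (ζ xs * (1 - g)) with hB
  have hg' : 0 < 1 - g := by linarith
  have hB0 : 0 ≤ B := by positivity
  set A := v xs (N + 1) / ζ xs ^ (N + 1) * Real.exp (B * g ^ (N + 1)) with hA
  have hA0 : 0 < A := by have := hpos N; positivity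
  have hmain : ∀ k, v xs (N + 1 + k) ≤ A * ζ xs ^ (N + 1 + k) * Real.exp (-(B * g ^ (N + 1 + k))) := by
    intro k
    induction k with
    | zero =>
      apply le_of_eq
      rw [hA, Real.exp_neg]
      simp only [add_zero]
      field_simp
    | succ k ih =>
      have s1 := hstep (N + k) (hN _ (by omega))
      rw [show N + k + 2 = N + 1 + (k + 1) by ring, show N + k + 1 = N + 1 + k by ring] at s1
      set n := N + 1 + k with hn
      rw [show N + 1 + (k + 1) = n + 1 by omega] at *
      have s2 : ζ xs + e n ≤ ζ xs * Real.exp (B * (1 - g) * g ^ n) := by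
        have t1 := Real.add_one_le_exp (B * (1 - g) * g ^ n)
        have t2 : ζ xs * (B * (1 - g) * g ^ n + 1) = M * g ^ n + ζ xs := by
          rw [hB]; field_simp
        have t3 := mul_le_mul_of_nonneg_left t1 z0.le
        linarith [heb n]
      calc v xs (n + 1) ≤ (ζ xs + e n) * v xs n := s1
        _ ≤ (ζ xs * Real.exp (B * (1 - g) * g ^ n)) *
            (A * ζ xs ^ n * Real.exp (-(B * g ^ n))) := by
            have := hnn n
            gcongr
        _ = A * ζ xs ^ (n + 1) * (Real.exp (B * (1 - g) * g ^ n) * Real.exp (-(B * g ^ n))) := by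
            ring
        _ = _ := by
            rw [← Real.exp_add]; congr 2; ring
  have hsum0 : 0 ≤ ∑ k ∈ Finset.range (N + 1), v xs k / ζ xs ^ k :=
    Finset.sum_nonneg fun k _ => by have := hnn k; positivity
  refine ⟨A + ∑ k ∈ Finset.range (N + 1), v xs k / ζ xs ^ k, by linarith, fun n => ?_⟩
  rw [← div_le_iff₀ (by positivity)]
  rcases lt_or_ge n (N + 1) with h | h
  · have := Finset.single_le_sum (f := fun k => v xs k / ζ xs ^ k)
      (fun k _ => by have := hnn k; positivity) (Finset.mem_range.2 h)
    linarith
  · obtain ⟨k, rfl⟩ := Nat.exists_eq_add_of_le h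
    have h2 : v xs (N + 1 + k) / ζ xs ^ (N + 1 + k) ≤ A := by
      rw [div_le_iff₀ (by positivity)]
      refine (hmain k).trans ?_
      refine mul_le_of_le_one_right (by positivity) ?_
      rw [Real.exp_le_one_iff]
      have : 0 ≤ B * g ^ (N + 1 + k) := by positivity
      linarith
    linarith

/-- If x₊ > 1, then v_n(x₊) ≤ C ζ(x₊)ⁿ for all n, for some constant C > 0. -/
theorem v_at_xstar_exponential_bound
    (q₀ α x₀ : ℝ) (hq1 : 1 / 2 < q₀) (hq2 : q₀ < 1)
    (hα1 : 1 - q₀ < α) (hα2 : α < q₀)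
    (hx : x₀ = 1 / (2 * Real.sqrt (q₀ * (1 - q₀))))
    (σ : ℕ → ℝ)
    (hσ0 : σ 0 = 2 * x₀ * α) (hσ : ∀ n, σ (n + 1) = 2 * x₀ - 1 / σ n)
    (v : ℝ → ℕ → ℝ)
    (hv0 : ∀ x, v x 0 = 0) (hv1 : ∀ x, v x 1 = 1)
    (hvr : ∀ x, ∀ n, 1 ≤ n →
      v x (n + 1) = (2 * x - σ (n + 1) + σ (n - 1)) * v x n - v x (n - 1))
    (ζ : ℝ → ℝ) (hζ : ∀ x, ζ x = x - Real.sqrt (x ^ 2 - 1))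
    (xs : ℝ) (hxs : xs = sInf {x : ℝ | ∀ n, 1 ≤ n → 0 < v x n})
    (h1 : 1 < xs) :
    ∃ C > (0 : ℝ), ∀ n : ℕ, v xs n ≤ C * ζ xs ^ n := by
  have hp : 0 < 1 - q₀ := by linarith
  have hq : 0 < q₀ := by linarith
  set r := Real.sqrt (q₀ * (1 - q₀)) with hr
  have hr0 : 0 < r := Real.sqrt_pos.2 (by positivity)
  have hr2 : r ^ 2 = q₀ * (1 - q₀) := Real.sq_sqrt (by positivity)
  set s := q₀ / r with hs
  have hs0 : 0 < s := by positivity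
  have hsi : 1 / s = (1 - q₀) / r := by
    rw [hs]; field_simp; linarith
  have hx2 : 2 * x₀ = s + 1 / s := by
    rw [hsi, hs, hx]; field_simp; ring
  have hσ0' : σ 0 = α / r := by rw [hσ0, hx]; field_simp
  have hlo : 1 / s < σ 0 := by rw [hsi, hσ0']; gcongr
  have hhi : σ 0 < s := by rw [hs, hσ0']; gcongr
  have hσ0p : 0 < σ 0 := lt_trans (by positivity) hlo
  have hone : 1 < s * σ 0 := by rw [div_lt_iff₀ hs0] at hlo; linarith
  have hdiff : ∀ n, 0 < σ n → s - σ (n + 1) = (s - σ n) / (s * σ n) := by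
    intro n hn
    rw [hσ, hx2]; field_simp; ring
  have hall : ∀ n, σ 0 ≤ σ n ∧ σ n < s := by
    intro n
    induction n with
    | zero => exact ⟨le_rfl, hhi⟩
    | succ k ih =>
      have hk : 0 < σ k := by linarith
      have h3 := hdiff k hk
      have h4 : 1 ≤ s * σ k := by nlinarith
      have h5 : (s - σ k) / (s * σ k) ≤ s - σ k := div_le_self (by linarith) h4
      have h6 : 0 < (s - σ k) / (s * σ k) := div_pos (by linarith) (by positivity)
      constructor <;> linarith
  have hstep : ∀ n, s - σ (n + 1) ≤ (s - σ n) * (1 / (s * σ 0)) := by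
    intro n
    obtain ⟨h3, h4⟩ := hall n
    rw [hdiff n (by linarith), mul_one_div]
    have : 0 ≤ s - σ n := by linarith
    gcongr
  set g := 1 / (s * σ 0) with hg
  have hg0 : 0 < g := by positivity
  have hg1 : g < 1 := by rw [hg, div_lt_one (by positivity)]; exact hone
  have hexp : ∀ n, s - σ n ≤ s * g ^ n := by
    intro n
    induction n with
    | zero => simp; linarith
    | succ k ih =>
      calc s - σ (k + 1) ≤ (s - σ k) * g := hstep k
        _ ≤ s * g ^ k * g := by gcongr
        _ = _ := by ring
  have hmono : ∀ n, σ n ≤ σ (n + 1) := by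
    intro n
    have h3 := hstep n
    have h4 := (hall n).2
    nlinarith
  refine abstract_bound (fun n => (s - σ n) + (s - σ (n + 1))) (2 * s) g (by positivity) hg0 hg1
    ?_ ?_ ?_ v hv0 hv1 ?_ ζ hζ xs hxs h1
  · intro n
    have h3 := (hall n).2
    have h4 := (hall (n + 1)).2
    linarith
  · intro n
    have h3 := hmono n
    have h4 := hmono (n + 1)
    linarith
  · intro n
    have h3 := hexp n
    have h4 := hmono n
    linarith
  · intro x n
    have h3 := hvr x (n + 1) (by omega)
    simp only [Nat.add_sub_cancel] at h3
    rw [show n + 2 = n + 1 + 1 from rfl, h3]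
    ring
end
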